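/- (Pascal's theorem, interpolation version.) Let A₁,…,A₆ be six distinct points in ℝ² such that the lines ℓ₁₂ and ℓ₄₅ meet in a unique point B₁, the lines ℓ₂₃ and ℓ₅₆ meet in a unique point B₂, and the lines ℓ₃₄ and ℓ₆₁ meet in a unique point B₃, where ℓᵢⱼ denotes the line through Aᵢ and Aⱼ. Then the set {A₁,…,A₆} is poised for Π₂ if and only if the set {B₁, B₂, B₃} is poised for Π₁, i.e., if and only if B₁, B₂, B₃ are not collinear. -/

import Mathlib

noncomputable section

/-- Points of the plane. -/
abbrev E : Type := ℝ × ℝ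

/-- A finite node set `N` is poised for a space `S` of functions `ℝ² → ℝ` if
for every data `c` there is a unique `f ∈ S` interpolating `c` on `N`. -/
def PoisedFor (S : Set (E → ℝ)) (N : Set E) : Prop :=
  ∀ c : E → ℝ, ∃! f : E → ℝ, f ∈ S ∧ ∀ x ∈ N, f x = c x

/-- `Π₂`: the bivariate polynomials of total degree at most `2`, as functions
`ℝ² → ℝ`. -/
def Pi2 : Set (E → ℝ) :=
  {f | ∃ a b c d e g : ℝ, ∀ x : E,
    f x = a + b * x.1 + c * x.2 + d * x.1 ^ 2 + e * (x.1 * x.2) +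
      g * x.2 ^ 2}

/-- `Π₁`: the bivariate polynomials of total degree at most `1`, as functions
`ℝ² → ℝ`. -/
def Pi1 : Set (E → ℝ) :=
  {f | ∃ a b c : ℝ, ∀ x : E, f x = a + b * x.1 + c * x.2}

/-- The cross product of `Q - P` and `R - P`; it vanishes iff `P`, `Q`, `R` are collinear. -/
def cross (P Q R : E) : ℝ :=
  (Q.1 - P.1) * (R.2 - P.2) - (Q.2 - P.2) * (R.1 - P.1)

/-- The cross product of the directions `Q - P` and `S - R`. -/
def dirCross (P Q R S : E) : ℝ :=
  (Q.1 - P.1) * (S.2 - R.2) - (Q.2 - P.2) * (S.1 - R.1)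

/-- The monomials of degree at most `1`. -/
def monomials₁ : Fin 3 → E → ℝ :=
  ![fun _ => 1, fun x => x.1, fun x => x.2]

/-- The monomials of degree at most `2`. -/
def monomials₂ : Fin 6 → E → ℝ :=
  ![fun _ => 1, fun x => x.1, fun x => x.2, fun x => x.1 ^ 2, fun x => x.1 * x.2,
    fun x => x.2 ^ 2]

theorem mem_affineSpan_pair_iff_cross {P Q : E} (h : P ≠ Q) (R : E) :
    R ∈ affineSpan ℝ {P, Q} ↔ cross P Q R = 0 := by
  obtain ⟨p, p'⟩ := P
  obtain ⟨q, q'⟩ := Q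
  obtain ⟨r, r'⟩ := R
  rw [mem_affineSpan_pair_iff_exists_lineMap_eq]
  simp only [cross, AffineMap.lineMap_apply, vsub_eq_sub, vadd_eq_add, Prod.mk_sub_mk,
    Prod.smul_mk, Prod.mk_add_mk, Prod.mk.injEq, smul_eq_mul]
  constructor
  · rintro ⟨t, rfl, rfl⟩
    ring
  · intro hc
    by_cases hx : q - p = 0
    · have hy : q' - p' ≠ 0 := fun hy => h (by
        rw [sub_eq_zero.mp hx, sub_eq_zero.mp hy])
      refine ⟨(r' - p') / (q' - p'), ?_, ?_⟩
      · field_simp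
        linear_combination hc
      · field_simp
        ring
    · refine ⟨(r - p) / (q - p), ?_, ?_⟩
      · field_simp
        ring
      · field_simp
        linear_combination -hc

theorem collinear_iff_cross (P Q R : E) :
    Collinear ℝ ({P, Q, R} : Set E) ↔ cross P Q R = 0 := by
  by_cases h : P = Q
  · subst h
    simp [cross, collinear_pair]
  · rw [← mem_affineSpan_pair_iff_cross h]
    refine ⟨fun hc => hc.mem_affineSpan_of_mem_of_ne (by simp) (by simp) (by simp) h,
      fun hR => (collinear_insert_of_mem_affineSpan_pair hR).subset ?_⟩
    rintro x (rfl | rfl | rfl) <;> simp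

/-- Interpolation by linear combinations of independent functions is governed by the collocation
determinant. -/
theorem poisedFor_range_iff_det_ne_zero {ι : Type*} [Fintype ι] [DecidableEq ι]
    {φ : ι → E → ℝ} (hφ : LinearIndependent ℝ φ) (A : ι → E) :
    PoisedFor {f | ∃ v : ι → ℝ, f = ∑ i, v i • φ i} (Set.range A) ↔
      (Matrix.of fun i j => φ j (A i)).det ≠ 0 := by
  set M : Matrix ι ι ℝ := Matrix.of fun i j => φ j (A i) with hM
  have eval_eq (v : ι → ℝ) (i : ι) : (∑ j, v j • φ j) (A i) = (M.mulVec v) i := by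
    simp [hM, Matrix.mulVec, dotProduct, mul_comm]
  constructor
  · intro h hdet
    obtain ⟨v, hv, hMv⟩ := Matrix.exists_mulVec_eq_zero_iff.mpr hdet
    have hz := (h 0).unique (y₁ := ∑ j, v j • φ j) (y₂ := 0) ⟨⟨v, rfl⟩, by
      rintro _ ⟨i, rfl⟩
      rw [eval_eq, hMv]; rfl⟩ ⟨⟨0, by simp⟩, by simp⟩
    exact hv (funext (Fintype.linearIndependent_iff.mp hφ v hz))
  · intro hdet c
    have hu : IsUnit M.det := isUnit_iff_ne_zero.mpr hdet
    refine ⟨∑ j, (M⁻¹.mulVec fun i => c (A i)) j • φ j, ⟨⟨_, rfl⟩, ?_⟩, ?_⟩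
    · rintro _ ⟨i, rfl⟩
      rw [eval_eq, Matrix.mulVec_mulVec, Matrix.mul_nonsing_inv _ hu, Matrix.one_mulVec]
    · rintro _ ⟨⟨v, rfl⟩, hv⟩
      have hMv : M.mulVec v = fun i => c (A i) :=
        funext fun i => by rw [← eval_eq, hv _ ⟨i, rfl⟩]
      rw [← hMv, Matrix.mulVec_mulVec, Matrix.nonsing_inv_mul _ hu, Matrix.one_mulVec]

theorem linearIndependent_monomials₂ : LinearIndependent ℝ monomials₂ := by
  rw [Fintype.linearIndependent_iff]
  intro v hv
  have h (x y : ℝ) := congrFun hv (x, y)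
  simp only [Fin.sum_univ_six, monomials₂, Pi.add_apply, Pi.smul_apply, smul_eq_mul,
    Pi.zero_apply, Matrix.cons_val] at h
  have h00 := h 0 0
  have h10 := h 1 0
  have h20 := h (-1) 0
  have h01 := h 0 1
  have h02 := h 0 (-1)
  have h11 := h 1 1
  intro i
  fin_cases i <;> dsimp <;> linarith

theorem linearIndependent_monomials₁ : LinearIndependent ℝ monomials₁ := by
  rw [Fintype.linearIndependent_iff]
  intro v hv
  have h (x y : ℝ) := congrFun hv (x, y)
  simp only [Fin.sum_univ_three, monomials₁, Pi.add_apply, Pi.smul_apply, smul_eq_mul,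
    Pi.zero_apply, Matrix.cons_val] at h
  have h00 := h 0 0
  have h10 := h 1 0
  have h01 := h 0 1
  intro i
  fin_cases i <;> dsimp <;> linarith

theorem pi1_eq : Pi1 = {f | ∃ v : Fin 3 → ℝ, f = ∑ i, v i • monomials₁ i} := by
  ext f
  constructor
  · rintro ⟨a, b, c, h⟩
    refine ⟨![a, b, c], funext fun x => ?_⟩
    simp [h, Fin.sum_univ_three, monomials₁]
  · rintro ⟨v, rfl⟩
    refine ⟨v 0, v 1, v 2, fun x => ?_⟩
    simp [Fin.sum_univ_three, monomials₁]

theorem pi2_eq : Pi2 = {f | ∃ v : Fin 6 → ℝ, f = ∑ i, v i • monomials₂ i} := by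
  ext f
  constructor
  · rintro ⟨a, b, c, d, e, g, h⟩
    refine ⟨![a, b, c, d, e, g], funext fun x => ?_⟩
    simp [h, Fin.sum_univ_six, monomials₂]
  · rintro ⟨v, rfl⟩
    refine ⟨v 0, v 1, v 2, v 3, v 4, v 5, fun x => ?_⟩
    simp [Fin.sum_univ_six, monomials₂]

theorem poisedFor_pi1_iff_cross_ne_zero (P Q R : E) :
    PoisedFor Pi1 {P, Q, R} ↔ cross P Q R ≠ 0 := by
  have h := poisedFor_range_iff_det_ne_zero linearIndependent_monomials₁ ![P, Q, R]
  rw [← pi1_eq, Matrix.range_cons, Matrix.range_cons, Matrix.range_cons, Matrix.range_empty,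
    Set.union_empty, Set.singleton_union, Set.singleton_union] at h
  rw [h]
  refine not_congr (Eq.congr_left ?_)
  simp [Matrix.det_fin_three, monomials₁, cross]
  ring

/-- The collocation matrix of the monomials of degree at most `2` at six points. -/
def conicMatrix (A : Fin 6 → E) : Matrix (Fin 6) (Fin 6) ℝ :=
  Matrix.of fun i j => monomials₂ j (A i)

theorem poisedFor_pi2_iff_det_ne_zero (A₁ A₂ A₃ A₄ A₅ A₆ : E) :
    PoisedFor Pi2 {A₁, A₂, A₃, A₄, A₅, A₆} ↔
      (conicMatrix ![A₁, A₂, A₃, A₄, A₅, A₆]).det ≠ 0 := by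
  have h := poisedFor_range_iff_det_ne_zero linearIndependent_monomials₂
    ![A₁, A₂, A₃, A₄, A₅, A₆]
  simpa only [conicMatrix, ← pi2_eq, Matrix.range_cons, Matrix.range_empty, Set.union_empty,
    Set.singleton_union] using h

theorem inter_coords {P Q R S B : E} (hPQ : P ≠ Q) (hRS : R ≠ S)
    (h : (↑(affineSpan ℝ {P, Q}) ∩ ↑(affineSpan ℝ {R, S}) : Set E) = {B}) :
    dirCross P Q R S ≠ 0 ∧ cross P Q B = 0 ∧ cross R S B = 0 := by
  have key (X : E) : cross P Q X = 0 ∧ cross R S X = 0 ↔ X = B := by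
    rw [← mem_affineSpan_pair_iff_cross hPQ, ← mem_affineSpan_pair_iff_cross hRS]
    exact Set.ext_iff.mp h X
  obtain ⟨h₁, h₂⟩ := (key B).mpr rfl
  refine ⟨fun hz => hPQ ?_, h₁, h₂⟩
  have hB : B + (Q - P) = B := by
    rw [← key]
    simp only [cross, dirCross, Prod.fst_add, Prod.snd_add, Prod.fst_sub, Prod.snd_sub] at *
    constructor
    · linear_combination h₁
    · linear_combination h₂ - hz
  exact (sub_eq_zero.mp (by simpa using hB)).symm

set_option maxHeartbeats 4000000 in
/-- The determinant deciding whether six points lie on a conic, as a bracket polynomial. -/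
theorem det_conicMatrix_eq (A₁ A₂ A₃ A₄ A₅ A₆ : E) :
    (conicMatrix ![A₁, A₂, A₃, A₄, A₅, A₆]).det =
      cross A₄ A₅ A₆ * cross A₄ A₂ A₃ * cross A₁ A₅ A₃ * cross A₁ A₂ A₆ -
      cross A₁ A₂ A₃ * cross A₁ A₅ A₆ * cross A₄ A₂ A₆ * cross A₄ A₅ A₃ := by
  simp [conicMatrix, monomials₂, Matrix.det_succ_row_zero, Fin.sum_univ_succ, Fin.succAbove, cross]
  ring

theorem dirCross_mul_coords {P Q R S B : E} (h₁ : cross P Q B = 0) (h₂ : cross R S B = 0) :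
    dirCross P Q R S * B.1 =
        (R.1 * S.2 - R.2 * S.1) * (Q.1 - P.1) - (P.1 * Q.2 - P.2 * Q.1) * (S.1 - R.1) ∧
      dirCross P Q R S * B.2 =
        (R.1 * S.2 - R.2 * S.1) * (Q.2 - P.2) - (P.1 * Q.2 - P.2 * Q.1) * (S.2 - R.2) := by
  simp only [cross, dirCross] at *
  constructor
  · linear_combination (S.1 - R.1) * h₁ - (Q.1 - P.1) * h₂
  · linear_combination (S.2 - R.2) * h₁ - (Q.2 - P.2) * h₂

/-- Pascal's theorem as a polynomial identity. -/
theorem det_conicMatrix_eq_cross {A₁ A₂ A₃ A₄ A₅ A₆ B₁ B₂ B₃ : E}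
    (h₁₂ : cross A₁ A₂ B₁ = 0) (h₄₅ : cross A₄ A₅ B₁ = 0)
    (h₂₃ : cross A₂ A₃ B₂ = 0) (h₅₆ : cross A₅ A₆ B₂ = 0)
    (h₃₄ : cross A₃ A₄ B₃ = 0) (h₆₁ : cross A₆ A₁ B₃ = 0) :
    (conicMatrix ![A₁, A₂, A₃, A₄, A₅, A₆]).det =
      -(dirCross A₁ A₂ A₄ A₅ * dirCross A₂ A₃ A₅ A₆ * dirCross A₃ A₄ A₆ A₁ *
        cross B₁ B₂ B₃) := by
  obtain ⟨x₁, y₁⟩ := dirCross_mul_coords h₁₂ h₄₅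
  obtain ⟨x₂, y₂⟩ := dirCross_mul_coords h₂₃ h₅₆
  obtain ⟨x₃, y₃⟩ := dirCross_mul_coords h₃₄ h₆₁
  have expand (z₁ z₂ z₃ : ℝ) : z₁ * z₂ * z₃ * cross B₁ B₂ B₃ =
      (z₁ * B₁.1) * ((z₂ * B₂.2) * z₃ - (z₃ * B₃.2) * z₂) -
      (z₁ * B₁.2) * ((z₂ * B₂.1) * z₃ - (z₃ * B₃.1) * z₂) +
      z₁ * ((z₂ * B₂.1) * (z₃ * B₃.2) - (z₂ * B₂.2) * (z₃ * B₃.1)) := by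
    simp only [cross]
    ring
  rw [det_conicMatrix_eq, expand, x₁, y₁, x₂, y₂, x₃, y₃]
  simp only [cross, dirCross]
  ring

/-- Pascal's theorem, interpolation version: if the six
distinct points `A₁, …, A₆` are such that the pairs of lines `ℓ₁₂, ℓ₄₅`;
`ℓ₂₃, ℓ₅₆`; `ℓ₃₄, ℓ₆₁` meet in unique points `B₁`, `B₂`, `B₃` respectively,
then `{A₁, …, A₆}` is poised for `Π₂` iff `{B₁, B₂, B₃}` is poised for
`Π₁`, i.e. iff `B₁, B₂, B₃` are not collinear. -/
theorem pascal_interpolation (A₁ A₂ A₃ A₄ A₅ A₆ B₁ B₂ B₃ : E)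
    (hdist : [A₁, A₂, A₃, A₄, A₅, A₆].Pairwise (· ≠ ·))
    (h₁ : (↑(affineSpan ℝ {A₁, A₂}) ∩ ↑(affineSpan ℝ {A₄, A₅}) : Set E)
      = {B₁})
    (h₂ : (↑(affineSpan ℝ {A₂, A₃}) ∩ ↑(affineSpan ℝ {A₅, A₆}) : Set E)
      = {B₂})
    (h₃ : (↑(affineSpan ℝ {A₃, A₄}) ∩ ↑(affineSpan ℝ {A₆, A₁}) : Set E)
      = {B₃}) :
    (PoisedFor Pi2 {A₁, A₂, A₃, A₄, A₅, A₆} ↔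
      PoisedFor Pi1 {B₁, B₂, B₃}) ∧
    (PoisedFor Pi1 {B₁, B₂, B₃} ↔
      ¬ Collinear ℝ ({B₁, B₂, B₃} : Set E)) := by
  simp only [List.pairwise_cons, List.mem_cons, List.not_mem_nil, or_false, forall_eq_or_imp,
    forall_eq] at hdist
  obtain ⟨⟨h₁₂, -, -, -, h₁₆⟩, ⟨h₂₃, -⟩, ⟨h₃₄, -⟩, ⟨h₄₅, -⟩, h₅₆, -⟩ := hdist
  obtain ⟨z₁, c₁₂, c₄₅⟩ := inter_coords h₁₂ h₄₅ h₁
  obtain ⟨z₂, c₂₃, c₅₆⟩ := inter_coords h₂₃ h₅₆ h₂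
  obtain ⟨z₃, c₃₄, c₆₁⟩ := inter_coords h₃₄ h₁₆.symm h₃
  rw [poisedFor_pi2_iff_det_ne_zero, poisedFor_pi1_iff_cross_ne_zero, collinear_iff_cross,
    det_conicMatrix_eq_cross c₁₂ c₄₅ c₂₃ c₅₆ c₃₄ c₆₁]
  simp [z₁, z₂, z₃]
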